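/- For every integer k ≥ 2, q(K_1 ∨ (kP_2 ∪ P_1)) = (2k + 3 + √(4k² + 4k + 9))/2; in particular q(K_1 ∨ (kP_2 ∪ P_1)) > 2k + 2. -/

import Mathlib

namespace QPaper

open SimpleGraph

/-- The signless Laplacian matrix `Q(G) = D(G) + A(G)` of a graph, over `ℝ`. -/
noncomputable def signlessLap {V : Type*} [Fintype V] [DecidableEq V] (G : SimpleGraph V) :
    Matrix V V ℝ :=
  letI := Classical.decRel G.Adj
  G.degMatrix ℝ + G.adjMatrix ℝ

/-- The `Q`-index of a graph: the largest eigenvalue of its signless Laplacian matrix. -/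
noncomputable def qIndex {V : Type*} [Fintype V] [DecidableEq V] (G : SimpleGraph V) : ℝ :=
  sSup (spectrum ℝ (signlessLap G))

/-- The number of edges (size) of a graph. -/
noncomputable def numEdges {V : Type*} (G : SimpleGraph V) : ℕ :=
  Nat.card G.edgeSet

/-- The degree of a vertex. -/
noncomputable def deg {V : Type*} (G : SimpleGraph V) (v : V) : ℕ :=
  Nat.card (G.neighborSet v)

/-- A graph is `2` leaves-free if it has at most one vertex of degree one. -/
def TwoLeavesFree {V : Type*} (G : SimpleGraph V) : Prop :=
  ∀ u v : V, deg G u = 1 → deg G v = 1 → u = v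

/-- The maximum degree `Δ(G)`. -/
noncomputable def maxDeg {V : Type*} [Fintype V] (G : SimpleGraph V) : ℕ :=
  letI := Classical.decEq V
  letI := Classical.decRel G.Adj
  G.maxDegree

/-- `k` disjoint copies of `P₂`, i.e. a perfect matching on `2k` vertices. -/
def matching (k : ℕ) : SimpleGraph (Fin k × Fin 2) :=
  SimpleGraph.fromRel (fun a b => a.1 = b.1)

/-- The star graph `Sₙ` on `n` vertices (`K_{1,n-1}` with center `0`). -/
def starGraph (n : ℕ) : SimpleGraph (Fin n) :=
  SimpleGraph.fromRel (fun a _ => (a : ℕ) = 0)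

/-- Disjoint union of two graphs. -/
def dUnion {α β : Type*} (G : SimpleGraph α) (H : SimpleGraph β) : SimpleGraph (α ⊕ β) :=
  SimpleGraph.fromRel (fun a b =>
    (∃ x y, a = Sum.inl x ∧ b = Sum.inl y ∧ G.Adj x y) ∨
    (∃ x y, a = Sum.inr x ∧ b = Sum.inr y ∧ H.Adj x y))

/-- The join `K₁ ∨ H` : a new vertex (`none`) adjacent to every vertex of `H`. -/
def cone {α : Type*} (H : SimpleGraph α) : SimpleGraph (Option α) :=
  SimpleGraph.fromRel (fun a b =>
    a = none ∨ ∃ x y, a = some x ∧ b = some y ∧ H.Adj x y)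

open scoped Classical in
theorem signlessLap_mulVec {V : Type*} [Fintype V] [DecidableEq V] (G : SimpleGraph V)
    (v : V → ℝ) (i : V) :
    (signlessLap G).mulVec v i = ∑ j, if G.Adj i j then v i + v j else 0 := by
  unfold signlessLap
  rw [Matrix.add_mulVec, Pi.add_apply, SimpleGraph.degMatrix, Matrix.mulVec_diagonal,
    SimpleGraph.adjMatrix_mulVec_apply, ← Finset.sum_filter, Finset.sum_add_distrib,
    Finset.sum_const, nsmul_eq_mul]
  have h : (Finset.univ.filter fun j => G.Adj i j) = G.neighborFinset i := by
    ext j; simp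
  rw [h]
  congr!

theorem mem_spectrum_iff_exists_mulVec {V : Type*} [Fintype V] [DecidableEq V]
    (M : Matrix V V ℝ) (μ : ℝ) :
    μ ∈ spectrum ℝ M ↔ ∃ v : V → ℝ, v ≠ 0 ∧ ∀ i, M.mulVec v i = μ * v i := by
  rw [← Matrix.spectrum_toLin', ← Module.End.hasEigenvalue_iff_mem_spectrum]
  constructor
  · intro h
    obtain ⟨v, hv⟩ := h.exists_hasEigenvector
    refine ⟨v, hv.2, fun i => ?_⟩
    have := congrFun hv.apply_eq_smul i
    simpa using this
  · rintro ⟨v, hv, h⟩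
    refine Module.End.hasEigenvalue_of_hasEigenvector (x := v) ⟨?_, hv⟩
    rw [Module.End.mem_eigenspace_iff]
    ext i
    simpa using h i

theorem cone_adj_none_some {α : Type*} (H : SimpleGraph α) (x : α) :
    (cone H).Adj none (some x) := by
  simp [cone]

theorem cone_adj_some_some {α : Type*} (H : SimpleGraph α) (x y : α) :
    (cone H).Adj (some x) (some y) ↔ H.Adj x y := by
  simp only [cone, fromRel_adj]
  have h1 := @SimpleGraph.ne_of_adj _ H x y
  have h2 := H.adj_comm x y
  simp
  tauto

theorem dUnion_adj_inl_inl {α β : Type*} (G : SimpleGraph α) (H : SimpleGraph β) (x y : α) :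
    (dUnion G H).Adj (Sum.inl x) (Sum.inl y) ↔ G.Adj x y := by
  have h1 := @SimpleGraph.ne_of_adj _ G x y
  have h2 := G.adj_comm x y
  simp [dUnion]
  tauto

theorem not_dUnion_adj_inl_inr {α β : Type*} (G : SimpleGraph α) (H : SimpleGraph β)
    (x : α) (y : β) : ¬ (dUnion G H).Adj (Sum.inl x) (Sum.inr y) := by
  simp [dUnion]

theorem matching_adj {k : ℕ} (i j : Fin k) (a b : Fin 2) :
    (matching k).Adj (i, a) (j, b) ↔ i = j ∧ a ≠ b := by
  simp [matching]
  grind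

section FriendshipWithPendant

variable (k : ℕ) (v : Option ((Fin k × Fin 2) ⊕ Fin 1) → ℝ)

theorem signlessLap_mulVec_center :
    (signlessLap (cone (dUnion (matching k) (pathGraph 1)))).mulVec v none =
      ∑ i : Fin k, ((v none + v (some (Sum.inl (i, 0)))) + (v none + v (some (Sum.inl (i, 1)))))
        + (v none + v (some (Sum.inr 0))) := by
  simp [signlessLap_mulVec, Fintype.sum_option, Fintype.sum_prod_type, Fin.sum_univ_two,
    cone_adj_none_some]

theorem signlessLap_mulVec_pendant :
    (signlessLap (cone (dUnion (matching k) (pathGraph 1)))).mulVec v (some (Sum.inr 0)) =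
      v (some (Sum.inr 0)) + v none := by
  have h (x) : ¬ (dUnion (matching k) (pathGraph 1)).Adj (Sum.inr 0) (Sum.inl x) :=
    fun h => not_dUnion_adj_inl_inr _ _ _ _ h.symm
  simp [signlessLap_mulVec, Fintype.sum_option, cone_adj_some_some,
    (cone_adj_none_some _ _).symm, h]

theorem signlessLap_mulVec_triangle (i : Fin k) (a : Fin 2) :
    (signlessLap (cone (dUnion (matching k) (pathGraph 1)))).mulVec v (some (Sum.inl (i, a))) =
      2 * v (some (Sum.inl (i, a))) + v (some (Sum.inl (i, 1 - a))) + v none := by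
  rw [signlessLap_mulVec]
  simp only [Fintype.sum_option, Fintype.sum_sum_type, Fintype.sum_prod_type, Fin.sum_univ_two,
    cone_adj_some_some, (cone_adj_none_some _ _).symm, dUnion_adj_inl_inl,
    not_dUnion_adj_inl_inr, matching_adj, if_true, if_false, Finset.sum_const_zero]
  rw [Finset.sum_eq_single i]
  · fin_cases a <;> simp <;> ring
  · intro j _ hj
    simp [hj.symm]
  · simp

end FriendshipWithPendant

theorem stmt15 (k : ℕ) (hk : 2 ≤ k) :
    qIndex (cone (dUnion (matching k) (pathGraph 1))) = (2 * (k : ℝ) + 3 + Real.sqrt (4 * (k : ℝ) ^ 2 + 4 * (k : ℝ) + 9)) / 2 ∧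
      qIndex (cone (dUnion (matching k) (pathGraph 1))) > 2 * (k : ℝ) + 2 := by
  set s := Real.sqrt (4 * (k : ℝ) ^ 2 + 4 * (k : ℝ) + 9)
  have hk' : (2 : ℝ) ≤ k := by exact_mod_cast hk
  have hsq : s ^ 2 = 4 * (k : ℝ) ^ 2 + 4 * (k : ℝ) + 9 := Real.sq_sqrt (by positivity)
  have hs0 : 0 ≤ s := Real.sqrt_nonneg _
  have hsgt : 2 * (k : ℝ) + 1 < s := by nlinarith
  set q := (2 * (k : ℝ) + 3 + s) / 2 with hq
  have hqgt : 2 * (k : ℝ) + 2 < q := by linarith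
  have hroot : q ^ 2 - (2 * k + 3) * q + 2 * k = 0 := by rw [hq]; nlinarith
  have hmax : IsGreatest (spectrum ℝ (signlessLap (cone (dUnion (matching k) (pathGraph 1)))))
      q := by
    constructor
    · rw [mem_spectrum_iff_exists_mulVec]
      have h1 : q - 1 ≠ 0 := by linarith
      have h3 : q - 3 ≠ 0 := by linarith
      refine ⟨fun o => o.elim 1 (Sum.elim (fun _ => 1 / (q - 3)) fun _ => 1 / (q - 1)),
        fun h => by simpa using congrFun h none, ?_⟩
      rintro (_ | ⟨i, a⟩ | j)
      · rw [signlessLap_mulVec_center]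
        simp
        field_simp
        linear_combination (2 - q) * hroot
      · rw [signlessLap_mulVec_triangle]
        simp
        field_simp
        ring
      · rw [Subsingleton.elim j 0, signlessLap_mulVec_pendant]
        simp
        field_simp
        ring
    · intro μ hμ
      rw [mem_spectrum_iff_exists_mulVec] at hμ
      obtain ⟨v, hv, h⟩ := hμ
      by_contra! hlt
      have h1 : μ - 1 ≠ 0 := by linarith
      have h3 : μ - 3 ≠ 0 := by linarith
      have htri (i : Fin k) (a : Fin 2) : v (some (Sum.inl (i, a))) = v none / (μ - 3) := by
        have e0 := h (some (Sum.inl (i, a)))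
        have e1 := h (some (Sum.inl (i, 1 - a)))
        rw [signlessLap_mulVec_triangle] at e0 e1
        rw [sub_sub_cancel] at e1
        have e : v (some (Sum.inl (i, 1 - a))) = v (some (Sum.inl (i, a))) :=
          mul_left_cancel₀ h1 (by linear_combination e0 - e1)
        rw [eq_div_iff h3]
        linear_combination e - e0
      have hpen : v (some (Sum.inr 0)) = v none / (μ - 1) := by
        have e := h (some (Sum.inr 0))
        rw [signlessLap_mulVec_pendant] at e
        rw [eq_div_iff h1]
        linear_combination -e
      have hc : v none ≠ 0 := by
        intro hc
        apply hv
        ext o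
        rcases o with _ | ⟨i, a⟩ | j
        · exact hc
        · simp [htri, hc]
        · rw [Subsingleton.elim j 0, hpen, hc]
          simp
      have e := h none
      rw [signlessLap_mulVec_center] at e
      simp only [htri, hpen, Finset.sum_const, Finset.card_univ, Fintype.card_fin,
        nsmul_eq_mul] at e
      field_simp at e
      have hpoly : (μ - 2) * (μ ^ 2 - (2 * k + 3) * μ + 2 * k) = 0 := by
        linear_combination -e
      have hpos : 0 < (μ - q) * (μ + q - (2 * k + 3)) :=
        mul_pos (by linarith) (by linarith)
      have hpos' : 0 < μ ^ 2 - (2 * k + 3) * μ + 2 * k := by nlinarith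
      exact (mul_pos (by linarith) hpos').ne' hpoly
  have hqi : qIndex (cone (dUnion (matching k) (pathGraph 1))) = q := hmax.csSup_eq
  exact ⟨hqi, hqi ▸ hqgt⟩

end QPaper
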